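/- For every integer n ≥ 5040 there exists a conflict collection of n-vertex graphs of cardinality exactly n(n−1)(n−2)(n−3)(n−4)(n−5) + 1. -/

import Mathlib

noncomputable section

/-- The Euclidean plane. -/
abbrev Plane := EuclideanSpace ℝ (Fin 2)

/-- `π` is a straight-line embedding of the simple graph `G` in the plane:
it is injective, the closed segments of two distinct edges meet only in images of
common endpoints, and no vertex image lies in the open segment of a non-incident edge. -/
def IsSLEmbedding {V : Type*} (G : SimpleGraph V) (π : V → Plane) : Prop :=
  Function.Injective π ∧
  (∀ u v x y : V, G.Adj u v → G.Adj x y → s(u, v) ≠ s(x, y) →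
    segment ℝ (π u) (π v) ∩ segment ℝ (π x) (π y) ⊆ π '' (({u, v} : Set V) ∩ ({x, y} : Set V))) ∧
  (∀ u v w : V, G.Adj u v → w ≠ u → w ≠ v → π w ∉ openSegment ℝ (π u) (π v))

/-- `G` embeds straight-line on the point set `P`. -/
def EmbedsOn {V : Type*} (G : SimpleGraph V) (P : Set Plane) : Prop :=
  ∃ π : V → Plane, IsSLEmbedding G π ∧ Set.range π = P

/-- `G` embeds straight-line on some point set (equivalently, `G` is planar). -/
def PlanarEmbeddable {V : Type*} (G : SimpleGraph V) : Prop :=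
  ∃ π : V → Plane, IsSLEmbedding G π

/-- A family of graphs on `n` vertices is simultaneously embeddable if there is a point
set of size `n` on which every member embeds straight-line. -/
def SimultaneouslyEmbeddable {n : ℕ} (𝒢 : Set (SimpleGraph (Fin n))) : Prop :=
  ∃ P : Finset Plane, P.card = n ∧ ∀ G ∈ 𝒢, EmbedsOn G ↑P

/-- A conflict collection: a family of planar-embeddable graphs on `n` vertices that is
not simultaneously embeddable. -/
def ConflictCollection {n : ℕ} (𝒢 : Set (SimpleGraph (Fin n))) : Prop :=
  (∀ G ∈ 𝒢, PlanarEmbeddable G) ∧ ¬ SimultaneouslyEmbeddable 𝒢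

/-! ### Triangles and complete graphs in straight-line embeddings -/

/-- The convex hull of a finite set is spanned by its common points with any other set that has
the same convex hull. -/
lemma convexHull_subset_convexHull_inter {X Y : Set Plane} (hX : X.Finite)
    (h : convexHull ℝ X = convexHull ℝ Y) :
    convexHull ℝ X ⊆ convexHull ℝ (X ∩ Y) := by
  have hext : (convexHull ℝ X).extremePoints ℝ ⊆ X ∩ Y :=
    Set.subset_inter extremePoints_convexHull_subset (h ▸ extremePoints_convexHull_subset)
  have hfin : (X ∩ Y).Finite := hX.inter_of_left Y
  rw [← closure_convexHull_extremePoints (hX.isCompact_convexHull ℝ) (convex_convexHull ℝ X)]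
  exact closure_minimal (convexHull_mono hext) (hfin.isClosed_convexHull ℝ)

/-- A segment leaving a nondegenerate triangle meets one of its sides. -/
lemma exists_mem_segment_side {A B C x y : Plane} (hABC : AffineIndependent ℝ ![A, B, C])
    (hx : x ∈ convexHull ℝ {A, B, C}) (hy : y ∉ convexHull ℝ {A, B, C}) :
    ∃ z ∈ segment ℝ x y, z ∈ segment ℝ A B ∨ z ∈ segment ℝ B C ∨ z ∈ segment ℝ A C := by
  have hfin : ({A, B, C} : Set Plane).Finite := by simp
  have hclosed := hfin.isClosed_convexHull ℝ
  obtain ⟨z, hz, hzf⟩ : ∃ z ∈ segment ℝ x y, z ∈ frontier (convexHull ℝ {A, B, C}) := by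
    by_contra! hno
    have hin : ∀ z ∈ segment ℝ x y, z ∈ convexHull ℝ {A, B, C} →
        z ∈ interior (convexHull ℝ {A, B, C}) := by
      intro z hz hzT
      by_contra hzi
      exact hno z hz ⟨subset_closure hzT, hzi⟩
    obtain ⟨z, -, hzi, hzc⟩ := (convex_segment (𝕜 := ℝ) x y).isPreconnected _ _
      isOpen_interior hclosed.isOpen_compl
      (fun z hz => (em (z ∈ convexHull ℝ {A, B, C})).imp (hin z hz) id)
      ⟨x, left_mem_segment ℝ x y, hin x (left_mem_segment ℝ x y) hx⟩
      ⟨y, right_mem_segment ℝ x y, hy⟩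
    exact hzc (interior_subset hzi)
  refine ⟨z, hz, ?_⟩
  let b : AffineBasis (Fin 3) ℝ Plane := ⟨![A, B, C], hABC, by
    rw [hABC.affineSpan_eq_top_iff_card_eq_finrank_add_one]; simp⟩
  have hb : Set.range b = {A, B, C} := by
    change Set.range ![A, B, C] = _
    ext x
    simp only [Set.mem_range, Fin.exists_fin_succ]
    simp [eq_comm]
  rw [frontier, hclosed.closure_eq, ← hb, b.interior_convexHull,
    b.convexHull_eq_nonneg_coord] at hzf
  obtain ⟨hnn, hnp⟩ := hzf
  simp only [Set.mem_ofPred_eq, Fin.forall_fin_succ, not_and_or] at hnn hnp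
  have hsum := b.sum_coord_apply_eq_one z
  have hlin := b.linear_combination_coord_eq_self z
  rw [Fin.sum_univ_three] at hsum hlin
  have h0 : b 0 = A := rfl
  have h1 : b 1 = B := rfl
  have h2 : b 2 = C := rfl
  rw [h0, h1, h2] at hlin
  have n0 : 0 ≤ b.coord 0 z := hnn.1
  have n1 : 0 ≤ b.coord 1 z := hnn.2.1
  have n2 : 0 ≤ b.coord 2 z := hnn.2.2.1
  have hzero : b.coord 0 z = 0 ∨ b.coord 1 z = 0 ∨ b.coord 2 z = 0 := by
    by_contra! hne
    have p0 := lt_of_le_of_ne n0 hne.1.symm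
    have p1 := lt_of_le_of_ne n1 hne.2.1.symm
    have p2 := lt_of_le_of_ne n2 hne.2.2.symm
    rcases hnp with h | h | h | h
    · exact h p0
    · exact h p1
    · exact h p2
    · exact h (fun i => i.elim0)
  rcases hzero with h | h | h <;> rw [h] at hsum hlin
  · exact .inr (.inl ⟨_, _, n1, n2, by linarith, by simpa using hlin⟩)
  · exact .inr (.inr ⟨_, _, n0, n2, by linarith, by simpa using hlin⟩)
  · exact .inl ⟨_, _, n0, n1, by linarith, by simpa using hlin⟩

lemma mem_convexHull_triple {A B C x : Plane} :
    x ∈ convexHull ℝ {A, B, C} ↔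
      ∃ a b c : ℝ, 0 ≤ a ∧ 0 ≤ b ∧ 0 ≤ c ∧ a + b + c = 1 ∧ a • A + b • B + c • C = x := by
  constructor
  · intro hx
    rw [convexHull_insert (by simp), convexHull_pair] at hx
    simp only [convexJoin_singleton_left, Set.mem_iUnion] at hx
    obtain ⟨y, ⟨b, c, hb, hc, hbc, rfl⟩, ⟨a, d, ha, hd, had, rfl⟩⟩ := hx
    refine ⟨a, d * b, d * c, ha, by positivity, by positivity, ?_, by module⟩
    rw [add_assoc, ← mul_add, hbc, mul_one, had]
  · rintro ⟨a, b, c, ha, hb, hc, habc, rfl⟩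
    have hmem : ∀ y ∈ ({A, B, C} : Set Plane), y ∈ convexHull ℝ {A, B, C} :=
      fun y hy => subset_convexHull ℝ _ hy
    have hconv := (convex_convexHull ℝ ({A, B, C} : Set Plane)).sum_mem
      (t := Finset.univ) (w := ![a, b, c]) (z := ![A, B, C])
      (by simp [Fin.forall_fin_succ, ha, hb, hc]) (by simp [Fin.sum_univ_three, habc])
      (by simp [Fin.forall_fin_succ, hmem])
    simpa [Fin.sum_univ_three] using hconv

/-- A point of a triangle cuts it into three triangles that cover it. -/
lemma mem_subtriangle_of_mem {A B C s t : Plane} (hs : s ∈ convexHull ℝ {A, B, C})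
    (ht : t ∈ convexHull ℝ {A, B, C}) :
    t ∈ convexHull ℝ {B, C, s} ∨ t ∈ convexHull ℝ {A, C, s} ∨ t ∈ convexHull ℝ {A, B, s} := by
  have key : ∀ {A B C : Plane} {a b c a' b' c' : ℝ}, 0 < c → 0 ≤ a' → 0 ≤ b' → 0 ≤ c' →
      a + b + c = 1 → a' + b' + c' = 1 → a * c' ≤ a' * c → b * c' ≤ b' * c →
      a' • A + b' • B + c' • C ∈ convexHull ℝ {A, B, a • A + b • B + c • C} := by
    intro A B C a b c a' b' c' hc ha' hb' hc' hsum hsum' h1 h2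
    rw [mem_convexHull_triple]
    refine ⟨a' - a * c' / c, b' - b * c' / c, c' / c, ?_, ?_, by positivity, ?_, ?_⟩
    · rw [sub_nonneg, div_le_iff₀ hc]; exact h1
    · rw [sub_nonneg, div_le_iff₀ hc]; exact h2
    · field_simp
      linear_combination c * hsum' - c' * hsum
    · match_scalars <;> field_simp <;> ring
  rw [mem_convexHull_triple] at hs ht
  obtain ⟨a, b, c, ha, hb, hc, hsum, rfl⟩ := hs
  obtain ⟨a', b', c', ha', hb', hc', hsum', rfl⟩ := ht
  have hA : 0 < a → b * a' ≤ b' * a → c * a' ≤ c' * a →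
      a' • A + b' • B + c' • C ∈ convexHull ℝ {B, C, a • A + b • B + c • C} := by
    intro h h1 h2
    have hperm : ∀ x y z : ℝ, x • A + y • B + z • C = y • B + z • C + x • A :=
      fun x y z => by abel
    rw [hperm, hperm]
    exact key h hb' hc' ha' (by linarith) (by linarith) h1 h2
  have hB : 0 < b → a * b' ≤ a' * b → c * b' ≤ c' * b →
      a' • A + b' • B + c' • C ∈ convexHull ℝ {A, C, a • A + b • B + c • C} := by
    intro h h1 h2
    have hperm : ∀ x y z : ℝ, x • A + y • B + z • C = x • A + z • C + y • B :=
      fun x y z => by abel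
    rw [hperm, hperm]
    exact key h ha' hc' hb' (by linarith) (by linarith) h1 h2
  have hC := fun h => key (A := A) (B := B) (C := C) h ha' hb' hc' hsum hsum'
  have hmin : ∃ i : Fin 3, 0 < ![a, b, c] i ∧
      ∀ j, ![a, b, c] j * ![a', b', c'] i ≤ ![a', b', c'] j * ![a, b, c] i := by
    have hpos : ∃ i, 0 < ![a, b, c] i := by
      by_contra! hn
      have h0 := hn 0
      have h1 := hn 1
      have h2 := hn 2
      simp at h0 h1 h2
      linarith
    obtain ⟨i, hi, hmin⟩ := (Finset.univ.filter fun i => 0 < ![a, b, c] i).exists_min_image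
      (fun i => ![a', b', c'] i / ![a, b, c] i) (by simpa [Finset.Nonempty] using hpos)
    simp only [Finset.mem_filter, Finset.mem_univ, true_and] at hi hmin
    have hnn : ∀ j, 0 ≤ ![a, b, c] j := by simp [Fin.forall_fin_succ, ha, hb, hc]
    have hnn' : ∀ j, 0 ≤ ![a', b', c'] j := by simp [Fin.forall_fin_succ, ha', hb', hc']
    refine ⟨i, hi, fun j => ?_⟩
    rcases (hnn j).eq_or_lt with hj | hj
    · rw [← hj, zero_mul]
      exact mul_nonneg (hnn' j) hi.le
    · have := hmin j hj
      rw [div_le_div_iff₀ hi hj] at this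
      linarith
  obtain ⟨i, hi, hle⟩ := hmin
  have l0 := hle 0
  have l1 := hle 1
  have l2 := hle 2
  fin_cases i <;> simp at hi l0 l1 l2
  · exact .inl (hA hi l1 l2)
  · exact .inr (.inl (hB hi l0 l2))
  · exact .inr (.inr (hC hi l0 l1))

namespace IsSLEmbedding

variable {V : Type*} {G : SimpleGraph V} {π : V → Plane}

lemma disjoint_segment (h : IsSLEmbedding G π) {u v x y : V} (huv : G.Adj u v) (hxy : G.Adj x y)
    (hux : u ≠ x) (huy : u ≠ y) (hvx : v ≠ x) (hvy : v ≠ y) :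
    Disjoint (segment ℝ (π u) (π v)) (segment ℝ (π x) (π y)) := by
  rw [Set.disjoint_iff]
  intro z hz
  obtain ⟨w, ⟨hw, hw'⟩, -⟩ := h.2.1 u v x y huv hxy (by simp [hux, huy]) hz
  simp only [Set.mem_insert_iff, Set.mem_singleton_iff] at hw hw'
  grind

lemma notMem_segment (h : IsSLEmbedding G π) {u v w : V} (huv : G.Adj u v) (hu : w ≠ u)
    (hv : w ≠ v) : π w ∉ segment ℝ (π u) (π v) := by
  rw [← insert_endpoints_openSegment]
  simp only [Set.mem_insert_iff, not_or]
  exact ⟨h.1.ne hu, h.1.ne hv, h.2.2 u v w huv hu hv⟩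

lemma affineIndependent (h : IsSLEmbedding G π) {a b c : V} (hab : G.Adj a b) (hbc : G.Adj b c)
    (hac : G.Adj a c) : AffineIndependent ℝ ![π a, π b, π c] := by
  rw [affineIndependent_iff_not_collinear_set]
  intro hcol
  rcases hcol.wbtw_or_wbtw_or_wbtw with hw | hw | hw
  · exact h.notMem_segment hac hab.ne' hbc.ne hw.mem_segment
  · exact h.notMem_segment hab.symm hbc.ne' hac.ne' hw.mem_segment
  · exact h.notMem_segment hbc.symm hac.ne hab.ne hw.mem_segment

/-- An edge of an embedded graph does not cross a disjoint triangle of the graph. -/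
lemma mem_triangle_of_adj (h : IsSLEmbedding G π) {a b c u v : V} (hab : G.Adj a b)
    (hbc : G.Adj b c) (hac : G.Adj a c) (huv : G.Adj u v) (hu : u ≠ a ∧ u ≠ b ∧ u ≠ c)
    (hv : v ≠ a ∧ v ≠ b ∧ v ≠ c) (hmem : π u ∈ convexHull ℝ {π a, π b, π c}) :
    π v ∈ convexHull ℝ {π a, π b, π c} := by
  by_contra hnot
  obtain ⟨z, hz, hz' | hz' | hz'⟩ :=
    exists_mem_segment_side (h.affineIndependent hab hbc hac) hmem hnot
  · exact (h.disjoint_segment huv hab hu.1 hu.2.1 hv.1 hv.2.1).le_bot ⟨hz, hz'⟩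
  · exact (h.disjoint_segment huv hbc hu.2.1 hu.2.2 hv.2.1 hv.2.2).le_bot ⟨hz, hz'⟩
  · exact (h.disjoint_segment huv hac hu.1 hu.2.2 hv.1 hv.2.2).le_bot ⟨hz, hz'⟩

lemma mem_triangle_iff_of_adj (h : IsSLEmbedding G π) {a b c u v : V} (hab : G.Adj a b)
    (hbc : G.Adj b c) (hac : G.Adj a c) (huv : G.Adj u v) (hu : u ≠ a ∧ u ≠ b ∧ u ≠ c)
    (hv : v ≠ a ∧ v ≠ b ∧ v ≠ c) :
    π u ∈ convexHull ℝ {π a, π b, π c} ↔ π v ∈ convexHull ℝ {π a, π b, π c} :=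
  ⟨h.mem_triangle_of_adj hab hbc hac huv hu hv, h.mem_triangle_of_adj hab hbc hac huv.symm hv hu⟩

/-- In an embedding of a complete graph on four vertices, one vertex lies in the triangle
spanned by the other three. -/
lemma mem_triangle_of_complete (h : IsSLEmbedding G π) {a b c d : V} (hab : G.Adj a b)
    (hac : G.Adj a c) (had : G.Adj a d) (hbc : G.Adj b c) (hbd : G.Adj b d) (hcd : G.Adj c d) :
    π d ∈ convexHull ℝ {π a, π b, π c} ∨ π a ∈ convexHull ℝ {π b, π c, π d} ∨
      π b ∈ convexHull ℝ {π a, π c, π d} ∨ π c ∈ convexHull ℝ {π a, π b, π d} := by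
  have hdep : ¬ AffineIndependent ℝ ![π a, π b, π c, π d] := by
    intro hind
    have := hind.card_le_finrank_succ
    have hle := (vectorSpan ℝ (Set.range ![π a, π b, π c, π d])).finrank_le
    simp at this hle
    omega
  obtain ⟨I, h0, hI⟩ : ∃ I : Set (Fin 4), 0 ∈ I ∧
      (convexHull ℝ (![π a, π b, π c, π d] '' I) ∩
        convexHull ℝ (![π a, π b, π c, π d] '' Iᶜ)).Nonempty := by
    obtain ⟨I, hI⟩ := Convex.radon_partition hdep
    by_cases h0 : 0 ∈ I
    · exact ⟨I, h0, hI⟩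
    · exact ⟨Iᶜ, h0, by rwa [compl_compl, Set.inter_comm]⟩
  have hmono : ∀ X Y : Set Plane, ![π a, π b, π c, π d] '' I ⊆ X →
      ![π a, π b, π c, π d] '' Iᶜ ⊆ Y → (convexHull ℝ X ∩ convexHull ℝ Y).Nonempty :=
    fun X Y hX hY => hI.mono (Set.inter_subset_inter (convexHull_mono hX) (convexHull_mono hY))
  have hsub : ∀ (J : Set (Fin 4)) (X : Set Plane), ![π a, π b, π c, π d] '' J ⊆ X ↔
      (0 ∈ J → π a ∈ X) ∧ (1 ∈ J → π b ∈ X) ∧ (2 ∈ J → π c ∈ X) ∧ (3 ∈ J → π d ∈ X) := by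
    intro J X
    simp [Set.image_subset_iff, Set.subset_def (s := J), Fin.forall_fin_succ]
  have hcross : ∀ {u v x y : V}, G.Adj u v → G.Adj x y → u ≠ x → u ≠ y → v ≠ x → v ≠ y →
      ¬ (convexHull ℝ {π u, π v} ∩ convexHull ℝ {π x, π y}).Nonempty := by
    intro u v x y huv hxy h1 h2 h3 h4
    rw [convexHull_pair, convexHull_pair, Set.not_nonempty_iff_eq_empty,
      ← Set.disjoint_iff_inter_eq_empty]
    exact h.disjoint_segment huv hxy h1 h2 h3 h4
  have hone : ∀ {x : Plane} {Y : Set Plane},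
      (convexHull ℝ {x} ∩ convexHull ℝ Y).Nonempty → x ∈ convexHull ℝ Y := by
    rintro x Y ⟨z, hz, hz'⟩
    rw [convexHull_singleton, Set.mem_singleton_iff] at hz
    exact hz ▸ hz'
  simp only [hsub, Set.mem_compl_iff] at hmono
  by_cases h1 : 1 ∈ I <;> by_cases h2 : 2 ∈ I <;> by_cases h3 : 3 ∈ I <;>
    simp only [h0, h1, h2, h3, not_true, not_false_iff, true_imp_iff, false_imp_iff, true_and,
      and_true] at hmono
  · simpa using hmono Set.univ ∅ (by simp)
  · exact .inl (hone (Set.inter_comm _ _ ▸ hmono {π a, π b, π c} {π d} (by simp) (by simp)))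
  · exact .inr (.inr (.inr (hone (Set.inter_comm _ _ ▸ hmono {π a, π b, π d} {π c} (by simp) (by simp)))))
  · exact absurd (hmono {π a, π b} {π c, π d} (by simp) (by simp))
      (hcross hab hcd hac.ne had.ne hbc.ne hbd.ne)
  · exact .inr (.inr (.inl (hone (Set.inter_comm _ _ ▸ hmono {π a, π c, π d} {π b} (by simp) (by simp)))))
  · exact absurd (hmono {π a, π c} {π b, π d} (by simp) (by simp))
      (hcross hac hbd hab.ne had.ne hbc.ne' hcd.ne)
  · exact absurd (hmono {π a, π d} {π b, π c} (by simp) (by simp))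
      (hcross had hbc hab.ne hac.ne hbd.ne' hcd.ne')
  · exact .inr (.inl (hone (hmono {π a} {π b, π c, π d} (by simp) (by simp))))

/-- Two vertices adjacent to all vertices of a triangle cannot both lie inside it. -/
lemma notMem_triangle_of_mem (h : IsSLEmbedding G π) {p q r s t : V} (hpq : G.Adj p q)
    (hqr : G.Adj q r) (hpr : G.Adj p r) (hsp : G.Adj s p) (hsq : G.Adj s q) (hsr : G.Adj s r)
    (htp : G.Adj t p) (htq : G.Adj t q) (htr : G.Adj t r) (hst : s ≠ t)
    (hs : π s ∈ convexHull ℝ {π p, π q, π r}) : π t ∉ convexHull ℝ {π p, π q, π r} := by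
  have key : ∀ {p q r : V}, G.Adj p q → G.Adj q r → G.Adj p r → G.Adj s p → G.Adj s q →
      G.Adj s r → G.Adj t p → G.Adj t q → G.Adj t r →
      π s ∈ convexHull ℝ {π p, π q, π r} → π t ∉ convexHull ℝ {π p, π q, π s} := by
    intro p q r hpq hqr hpr hsp hsq hsr htp htq htr hs ht
    have hr := h.mem_triangle_of_adj hpq hsq.symm hsp.symm htr ⟨htp.ne, htq.ne, hst.symm⟩
      ⟨hpr.ne', hqr.ne', hsr.ne'⟩ ht
    have hmem : ∀ {A B C x : Plane}, x = A ∨ x = B ∨ x = C → x ∈ convexHull ℝ {A, B, C} :=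
      fun hx => subset_convexHull ℝ _ (by simpa using hx)
    have heq : convexHull ℝ {π p, π q, π s} = convexHull ℝ {π p, π q, π r} := by
      apply Set.Subset.antisymm <;> refine convexHull_min ?_ (convex_convexHull ℝ _)
      · rintro _ (rfl | rfl | rfl)
        exacts [hmem (by simp), hmem (by simp), hs]
      · rintro _ (rfl | rfl | rfl)
        exacts [hmem (by simp), hmem (by simp), hr]
    have hs' := convexHull_subset_convexHull_inter (by simp) heq
      (hmem (x := π s) (by simp))
    have hinter : ({π p, π q, π s} ∩ {π p, π q, π r} : Set Plane) ⊆ {π p, π q} := by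
      rintro _ ⟨rfl | rfl | rfl, hx⟩
      · simp
      · simp
      · simpa [h.1.eq_iff, hsr.ne] using hx
    have := convexHull_mono hinter hs'
    rw [convexHull_pair] at this
    exact h.notMem_segment hpq hsp.ne hsq.ne this
  intro ht
  rcases mem_subtriangle_of_mem hs ht with ht | ht | ht
  · refine key hqr hpr.symm hpq.symm hsq hsr hsp htq htr htp ?_ ht
    convert hs using 2
    ext; simp; tauto
  · refine key hpr hqr.symm hpq hsp hsr hsq htp htr htq ?_ ht
    convert hs using 2
    ext; simp; tauto
  · exact key hpq hqr hpr hsp hsq hsr htp htq htr hs ht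

/-- Two vertices adjacent to all vertices of a triangle cannot both lie outside it. -/
lemma mem_triangle_of_notMem (h : IsSLEmbedding G π) {p q r s t : V} (hpq : G.Adj p q)
    (hqr : G.Adj q r) (hpr : G.Adj p r) (hsp : G.Adj s p) (hsq : G.Adj s q) (hsr : G.Adj s r)
    (htp : G.Adj t p) (htq : G.Adj t q) (htr : G.Adj t r) (hst : s ≠ t)
    (hs : π s ∉ convexHull ℝ {π p, π q, π r}) : π t ∈ convexHull ℝ {π p, π q, π r} := by
  by_contra ht
  have hsubset : ∀ (X : Set Plane), X ⊆ convexHull ℝ X := subset_convexHull ℝ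
  obtain ⟨Y, hY, hall⟩ : ∃ Y : Set Plane, Y ⊆ {π p, π q, π r, π t} ∧
      {π p, π q, π r, π s} ⊆ convexHull ℝ Y := by
    rcases h.mem_triangle_of_complete hpq hpr htp.symm hqr htq.symm htr.symm with hd | hp | hq | hr
    · exact absurd hd ht
    · refine ⟨{π q, π r, π t}, by simp, ?_⟩
      rintro _ (rfl | rfl | rfl | rfl)
      · exact hp
      · exact hsubset _ (by simp)
      · exact hsubset _ (by simp)
      · exact h.mem_triangle_of_adj hqr htr.symm htq.symm hsp.symm
          ⟨hpq.ne, hpr.ne, htp.ne'⟩ ⟨hsq.ne, hsr.ne, hst⟩ hp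
    · refine ⟨{π p, π r, π t}, by simp [Set.insert_subset_iff], ?_⟩
      rintro _ (rfl | rfl | rfl | rfl)
      · exact hsubset _ (by simp)
      · exact hq
      · exact hsubset _ (by simp)
      · exact h.mem_triangle_of_adj hpr htr.symm htp.symm hsq.symm
          ⟨hpq.ne', hqr.ne, htq.ne'⟩ ⟨hsp.ne, hsr.ne, hst⟩ hq
    · refine ⟨{π p, π q, π t}, by simp [Set.insert_subset_iff], ?_⟩
      rintro _ (rfl | rfl | rfl | rfl)
      · exact hsubset _ (by simp)
      · exact hsubset _ (by simp)
      · exact hr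
      · exact h.mem_triangle_of_adj hpq htq.symm htp.symm hsr.symm
          ⟨hpr.ne', hqr.ne', htr.ne'⟩ ⟨hsp.ne, hsq.ne, hst⟩ hr
  have key : ∀ {p q r : V}, G.Adj p q → G.Adj q r → G.Adj p r → G.Adj s p → G.Adj s q →
      G.Adj s r → G.Adj t p → G.Adj t q → G.Adj t r → Y ⊆ {π p, π q, π r, π t} →
      {π p, π q, π r, π s} ⊆ convexHull ℝ Y → π p ∉ convexHull ℝ {π q, π r, π s} := by
    intro p q r hpq hqr hpr hsp hsq hsr htp htq htr hY hall hp
    have htmem := h.mem_triangle_of_adj hqr hsr.symm hsq.symm htp.symm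
      ⟨hpq.ne, hpr.ne, hsp.ne'⟩ ⟨htq.ne, htr.ne, hst.symm⟩ hp
    have heq : convexHull ℝ {π q, π r, π s} = convexHull ℝ Y := by
      apply Set.Subset.antisymm <;> refine convexHull_min ?_ (convex_convexHull ℝ _)
      · exact (Set.subset_insert _ _).trans hall
      · refine hY.trans ?_
        rintro _ (rfl | rfl | rfl | rfl)
        exacts [hp, hsubset _ (by simp), hsubset _ (by simp), htmem]
    have hp' := convexHull_subset_convexHull_inter (by simp) heq hp
    have hinter : ({π q, π r, π s} ∩ Y : Set Plane) ⊆ {π q, π r} := by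
      rintro _ ⟨rfl | rfl | rfl, hx⟩
      · simp
      · simp
      · simpa [h.1.eq_iff, hsp.ne, hst] using hY hx
    have := convexHull_mono hinter hp'
    rw [convexHull_pair] at this
    exact h.notMem_segment hqr hpq.ne hpr.ne this
  rcases h.mem_triangle_of_complete hpq hpr hsp.symm hqr hsq.symm hsr.symm with hd | hp | hq | hr
  · exact hs hd
  · exact key hpq hqr hpr hsp hsq hsr htp htq htr hY hall hp
  · refine key hpq.symm hpr hqr hsq hsp hsr htq htp htr ?_ ?_ hq
    · rwa [Set.insert_comm]
    · rwa [Set.insert_comm]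
  · refine key hpr.symm hpq hqr.symm hsr hsp hsq htr htp htq ?_ ?_ hr
    · refine hY.trans fun x hx => ?_
      simp only [Set.mem_insert_iff] at hx ⊢
      tauto
    · refine subset_trans (fun x hx => ?_) hall
      simp only [Set.mem_insert_iff] at hx ⊢
      tauto

/-- A triangle separates any two vertices adjacent to all of its vertices. -/
lemma mem_triangle_iff_notMem (h : IsSLEmbedding G π) {p q r s t : V} (hpq : G.Adj p q)
    (hqr : G.Adj q r) (hpr : G.Adj p r) (hsp : G.Adj s p) (hsq : G.Adj s q) (hsr : G.Adj s r)
    (htp : G.Adj t p) (htq : G.Adj t q) (htr : G.Adj t r) (hst : s ≠ t) :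
    π s ∈ convexHull ℝ {π p, π q, π r} ↔ π t ∉ convexHull ℝ {π p, π q, π r} :=
  ⟨h.notMem_triangle_of_mem hpq hqr hpr hsp hsq hsr htp htq htr hst, fun ht =>
    h.mem_triangle_of_notMem hpq hqr hpr htp htq htr hsp hsq hsr hst.symm ht⟩

end IsSLEmbedding

/-! ### The graphs of the collection -/

/-- The vertices of the stacked triangulation underlying the construction: six core vertices,
which form a triangulation with eight faces, and one further vertex for each face. -/
abbrev Site := Fin 6 ⊕ Fin 8

/-- Adjacency of core vertices: two adjacent vertices `0`, `1`, both joined to all vertices of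
the path `2`, `3`, `4`, `5`. -/
def coreAdj (i j : Fin 6) : Bool :=
  i ≠ j && (i < 2 || j < 2 || i.val + 1 = j.val || j.val + 1 = i.val)

/-- The three core vertices on the boundary of a face. -/
def corner (f : Fin 8) : Fin 3 → Fin 6 :=
  ![![0, 1, 2], ![0, 1, 5], ![0, 2, 3], ![0, 3, 4], ![0, 4, 5], ![1, 2, 3], ![1, 3, 4],
    ![1, 4, 5]] f

/-- A core vertex off the face that is adjacent to all of its corners. -/
def apex : Fin 8 → Fin 6 := ![3, 4, 1, 1, 1, 0, 0, 0]

/-- Adjacency in the triangulation with all sites: core edges, and edges from each face to its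
corners. -/
def siteAdj : Site → Site → Bool
  | .inl i, .inl j => coreAdj i j
  | .inl i, .inr f => i = corner f 0 || i = corner f 1 || i = corner f 2
  | .inr f, .inl i => i = corner f 0 || i = corner f 1 || i = corner f 2
  | .inr _, .inr _ => false

lemma siteAdj_symm : ∀ a b : Site, siteAdj a b = siteAdj b a := by decide

lemma siteAdj_irrefl : ∀ a : Site, siteAdj a a = false := by decide

/-- `v` is the first vertex assigned to its site. -/
def IsFirst {n : ℕ} (β : Fin n → Site) (v : Fin n) : Prop := ∀ u, β u = β v → v ≤ u

lemma IsFirst.eq {n : ℕ} {β : Fin n → Site} {u v : Fin n} (hu : IsFirst β u) (hv : IsFirst β v)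
    (h : β u = β v) : u = v :=
  le_antisymm (hu v h.symm) (hv u h)

lemma exists_isFirst {n : ℕ} (β : Fin n → Site) (v : Fin n) : ∃ u, IsFirst β u ∧ β u = β v := by
  obtain ⟨u, hu, hmin⟩ := (Finset.univ.filter fun u => β u = β v).exists_min_image id ⟨v, by simp⟩
  simp only [Finset.mem_filter, Finset.mem_univ, true_and, id] at hu hmin
  exact ⟨u, fun w hw => hmin w (hw.trans hu), hu⟩

/-- The graph in which the vertices are distributed over the sites according to `β`: the first
vertices of the sites are joined as in the triangulation, and the other vertices of a site are
pendant vertices at its first one. -/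
def siteGraph {n : ℕ} (β : Fin n → Site) : SimpleGraph (Fin n) where
  Adj u v := (IsFirst β u ∧ IsFirst β v ∧ siteAdj (β u) (β v)) ∨
    (β u = β v ∧ u ≠ v ∧ (IsFirst β u ∨ IsFirst β v))
  symm := ⟨fun u v h => by
    rw [siteAdj_symm (β v), eq_comm (a := β v), ne_comm (a := v)]
    tauto⟩
  loopless := ⟨fun u h => by simp [siteAdj_irrefl] at h⟩

/-! ### The graphs are planar -/

/-- Twice the signed area of a triangle. -/
def orient (A B C : Plane) : ℝ :=
  (B 0 - A 0) * (C 1 - A 1) - (B 1 - A 1) * (C 0 - A 0)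

lemma orient_combo (A B C D : Plane) {a b : ℝ} (hab : a + b = 1) :
    orient A B (a • C + b • D) = a * orient A B C + b * orient A B D := by
  obtain rfl : b = 1 - a := by linarith
  simp [orient]
  ring

lemma orient_eq_zero_of_mem_segment {A B z : Plane} (hz : z ∈ segment ℝ A B) :
    orient A B z = 0 := by
  obtain ⟨a, b, -, -, hab, rfl⟩ := hz
  rw [orient_combo _ _ _ _ hab]
  simp [orient]
  right
  ring

lemma disjoint_segment_of_orient {A B C D : Plane} (h : 0 < orient A B C * orient A B D) :
    Disjoint (segment ℝ A B) (segment ℝ C D) := by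
  rw [Set.disjoint_left]
  intro z hz hz'
  have h0 := orient_eq_zero_of_mem_segment hz
  obtain ⟨a, b, ha, hb, hab, rfl⟩ := hz'
  rw [orient_combo _ _ _ _ hab] at h0
  rcases pos_and_pos_or_neg_and_neg_of_mul_pos h with ⟨h1, h2⟩ | ⟨h1, h2⟩ <;>
    rcases ha.eq_or_lt with rfl | ha' <;> nlinarith

lemma segment_inter_segment_of_orient {A B C : Plane} (h : orient A B C ≠ 0) :
    segment ℝ A B ∩ segment ℝ A C ⊆ {A} := by
  rintro z ⟨hz, hz'⟩
  have h0 := orient_eq_zero_of_mem_segment hz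
  obtain ⟨a, b, ha, hb, hab, rfl⟩ := hz'
  rw [orient_combo _ _ _ _ hab, orient_eq_zero_of_mem_segment (left_mem_segment ℝ A B), mul_zero,
    zero_add] at h0
  obtain rfl : b = 0 := (mul_eq_zero.1 h0).resolve_right h
  obtain rfl : a = 1 := by linarith
  simp

/-- A criterion for straight-line embeddings in terms of orientations of triples of points. -/
lemma isSLEmbedding_of_orient {V : Type*} {G : SimpleGraph V} {π : V → Plane}
    (hinj : Function.Injective π)
    (hgen : ∀ u v w, G.Adj u v → w ≠ u → w ≠ v → orient (π u) (π v) (π w) ≠ 0)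
    (hsep : ∀ u v x y, G.Adj u v → G.Adj x y → u ≠ x → u ≠ y → v ≠ x → v ≠ y →
      0 < orient (π u) (π v) (π x) * orient (π u) (π v) (π y) ∨
      0 < orient (π x) (π y) (π u) * orient (π x) (π y) (π v)) :
    IsSLEmbedding G π := by
  refine ⟨hinj, fun u v x y huv hxy hne => ?_, fun u v w huv hwu hwv hmem =>
    hgen u v w huv hwu hwv (orient_eq_zero_of_mem_segment (openSegment_subset_segment ℝ _ _ hmem))⟩
  have key : ∀ {u v w : V}, G.Adj u v → w ≠ u → w ≠ v →
      segment ℝ (π u) (π v) ∩ segment ℝ (π u) (π w) ⊆ {π u} := fun huv hwu hwv =>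
    segment_inter_segment_of_orient (hgen _ _ _ huv hwu hwv)
  by_cases hux : u = x
  · subst hux
    refine (key huv hxy.ne' (by rintro rfl; exact hne rfl)).trans ?_
    exact Set.singleton_subset_iff.2 ⟨u, by simp, rfl⟩
  by_cases huy : u = y
  · subst huy
    rw [segment_symm ℝ (π x)]
    refine (key huv hxy.ne (by rintro rfl; exact hne Sym2.eq_swap)).trans ?_
    exact Set.singleton_subset_iff.2 ⟨u, by simp, rfl⟩
  by_cases hvx : v = x
  · subst hvx
    rw [segment_symm ℝ (π u)]
    refine (key huv.symm hxy.ne' (by rintro rfl; exact hne Sym2.eq_swap)).trans ?_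
    exact Set.singleton_subset_iff.2 ⟨v, by simp, rfl⟩
  by_cases hvy : v = y
  · subst hvy
    rw [segment_symm ℝ (π u), segment_symm ℝ (π x)]
    refine (key huv.symm hxy.ne (by rintro rfl; exact hne rfl)).trans ?_
    exact Set.singleton_subset_iff.2 ⟨v, by simp, rfl⟩
  rw [Set.disjoint_iff_inter_eq_empty.1]
  · exact Set.empty_subset _
  rcases hsep u v x y huv hxy hux huy hvx hvy with h | h
  · exact disjoint_segment_of_orient h
  · exact (disjoint_segment_of_orient h).symm

/-- Abscissas of the sites in a drawing of the triangulation. -/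
def siteX : Site → ℤ :=
  Sum.elim ![-32, 32, -1, -1, 0, 1] ![-3, 2, -12, -13, -11, 10, 11, 11]

/-- Ordinates of the sites in a drawing of the triangulation. -/
def siteY : Site → ℤ :=
  Sum.elim ![0, -3, 12, 18, 24, 29] ![5, 32, 9, 14, 17, 10, 13, 15]

/-- Twice the signed area of a triangle of sites in the drawing. -/
def siteOrient (a b c : Site) : ℤ :=
  (siteX b - siteX a) * (siteY c - siteY a) - (siteY b - siteY a) * (siteX c - siteX a)

lemma siteX_mem : ∀ a, -32 ≤ siteX a ∧ siteX a ≤ 32 := by decide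

lemma siteY_mem : ∀ a, -32 ≤ siteY a ∧ siteY a ≤ 32 := by decide

lemma siteY_injective : Function.Injective siteY := by
  intro a b
  revert a b
  decide

lemma siteOrient_ne_zero : ∀ a b, siteAdj a b → ∀ c, c ≠ a → c ≠ b → siteOrient a b c ≠ 0 := by
  decide +kernel

lemma siteOrient_mul_pos : ∀ a b, siteAdj a b → ∀ c d, siteAdj c d → a ≠ c → a ≠ d → b ≠ c →
    b ≠ d → 0 < siteOrient a b c * siteOrient a b d ∨ 0 < siteOrient c d a * siteOrient c d b := by
  decide +kernel

section Drawing

variable {n : ℕ} {β : Fin n → Site}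

open Classical in
/-- Horizontal displacement of a vertex from its site in the drawing. -/
def offsetX (β : Fin n → Site) (v : Fin n) : ℝ := if IsFirst β v then 0 else 100

open Classical in
/-- Vertical displacement of a vertex from its site in the drawing. -/
def offsetY (β : Fin n → Site) (v : Fin n) : ℝ :=
  if IsFirst β v then 0 else ((v : ℝ) + 1) / (n + 1)

/-- A drawing of the graph: pendant vertices are placed close to their neighbours, in almost
horizontal directions. -/
def drawing (β : Fin n → Site) (v : Fin n) : Plane :=
  !₂[10000 * (siteX (β v) : ℝ) + offsetX β v, 10000 * (siteY (β v) : ℝ) + offsetY β v]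

lemma offsetX_mem (v : Fin n) : 0 ≤ offsetX β v ∧ offsetX β v ≤ 100 := by
  unfold offsetX
  split_ifs <;> norm_num

lemma offsetY_mem (v : Fin n) : 0 ≤ offsetY β v ∧ offsetY β v ≤ 1 := by
  unfold offsetY
  have hv : (v : ℝ) < n := by exact_mod_cast v.2
  split_ifs
  · norm_num
  · refine ⟨by positivity, ?_⟩
    rw [div_le_one (by positivity)]
    linarith

lemma offsetY_pos {v : Fin n} (hv : ¬ IsFirst β v) : 0 < offsetY β v := by
  rw [offsetY, if_neg hv]
  positivity

lemma offsetY_ne {u v : Fin n} (hv : ¬ IsFirst β v) (huv : u ≠ v) :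
    offsetY β u ≠ offsetY β v := by
  by_cases hu : IsFirst β u
  · rw [offsetY, if_pos hu]
    exact (offsetY_pos hv).ne
  · rw [offsetY, offsetY, if_neg hu, if_neg hv]
    intro h
    rw [div_left_inj' (by positivity)] at h
    apply huv
    have : (u : ℝ) = v := by linarith
    exact Fin.ext (by exact_mod_cast this)

lemma orient_drawing_of_isFirst {u v : Fin n} (hu : IsFirst β u) (hv : IsFirst β v) (w : Fin n) :
    orient (drawing β u) (drawing β v) (drawing β w) =
      10000 ^ 2 * (siteOrient (β u) (β v) (β w) : ℝ) +
      10000 * (((siteX (β v) : ℝ) - siteX (β u)) * offsetY β w -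
        ((siteY (β v) : ℝ) - siteY (β u)) * offsetX β w) := by
  have hxu : offsetX β u = 0 := if_pos hu
  have hyu : offsetY β u = 0 := if_pos hu
  have hxv : offsetX β v = 0 := if_pos hv
  have hyv : offsetY β v = 0 := if_pos hv
  simp [orient, drawing, siteOrient, hxu, hyu, hxv, hyv]
  ring

lemma orient_drawing_of_pendant {u v : Fin n} (huv : β u = β v) (hu : IsFirst β u)
    (hv : ¬ IsFirst β v) (w : Fin n) :
    orient (drawing β u) (drawing β v) (drawing β w) =
      100 * (10000 * ((siteY (β w) : ℝ) - siteY (β u)) + offsetY β w) -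
      offsetY β v * (10000 * ((siteX (β w) : ℝ) - siteX (β u)) + offsetX β w) := by
  have hxu : offsetX β u = 0 := if_pos hu
  have hyu : offsetY β u = 0 := if_pos hu
  have hxv : offsetX β v = 100 := if_neg hv
  simp [orient, drawing, hxu, hyu, hxv, huv]
  ring

lemma orient_swap (A B C : Plane) : orient B A C = -orient A B C := by
  simp only [orient]
  ring

lemma siteX_sub_mem (a b : Site) :
    -64 ≤ (siteX a : ℝ) - siteX b ∧ (siteX a : ℝ) - siteX b ≤ 64 := by
  have ha := siteX_mem a
  have hb := siteX_mem b
  constructor <;> norm_cast <;> omega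

lemma siteY_sub_mem (a b : Site) :
    -64 ≤ (siteY a : ℝ) - siteY b ∧ (siteY a : ℝ) - siteY b ≤ 64 := by
  have ha := siteY_mem a
  have hb := siteY_mem b
  constructor <;> norm_cast <;> omega

lemma siteY_sub_cases {a b : Site} (hab : a ≠ b) :
    (siteY a : ℝ) - siteY b ≤ -1 ∨ 1 ≤ (siteY a : ℝ) - siteY b := by
  have := siteY_injective.ne hab
  norm_cast
  omega

lemma orient_drawing_mul_siteOrient_pos {u v w : Fin n} (hu : IsFirst β u) (hv : IsFirst β v)
    (huv : siteAdj (β u) (β v)) (hwu : β w ≠ β u) (hwv : β w ≠ β v) :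
    0 < orient (drawing β u) (drawing β v) (drawing β w) *
      (siteOrient (β u) (β v) (β w) : ℝ) := by
  rw [orient_drawing_of_isFirst hu hv]
  have hO := siteOrient_ne_zero _ _ huv _ hwu hwv
  obtain ⟨x1, x2⟩ := siteX_sub_mem (β v) (β u)
  obtain ⟨y1, y2⟩ := siteY_sub_mem (β v) (β u)
  obtain ⟨a1, a2⟩ := offsetX_mem (β := β) w
  obtain ⟨b1, b2⟩ := offsetY_mem (β := β) w
  have hcross : |((siteX (β v) : ℝ) - siteX (β u)) * offsetY β w -
      ((siteY (β v) : ℝ) - siteY (β u)) * offsetX β w| ≤ 6464 := by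
    rw [abs_le]
    constructor <;> nlinarith
  rw [abs_le] at hcross
  obtain ⟨c1, c2⟩ := hcross
  rcases lt_or_gt_of_ne hO with h | h
  · have h' : (siteOrient (β u) (β v) (β w) : ℝ) ≤ -1 := by exact_mod_cast Int.le_sub_one_of_lt h
    exact mul_pos_of_neg_of_neg (by linarith) (by linarith)
  · have h' : (1 : ℝ) ≤ siteOrient (β u) (β v) (β w) := by exact_mod_cast h
    exact mul_pos (by linarith) (by linarith)

lemma orient_drawing_mul_siteY_pos {u v w : Fin n} (huv : β u = β v) (hu : IsFirst β u)
    (hv : ¬ IsFirst β v) (hwu : β w ≠ β u) :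
    0 < orient (drawing β u) (drawing β v) (drawing β w) *
      ((siteY (β w) : ℝ) - siteY (β u)) := by
  rw [orient_drawing_of_pendant huv hu hv]
  obtain ⟨x1, x2⟩ := siteX_sub_mem (β w) (β u)
  obtain ⟨a1, a2⟩ := offsetX_mem (β := β) w
  obtain ⟨b1, b2⟩ := offsetY_mem (β := β) w
  obtain ⟨c1, c2⟩ := offsetY_mem (β := β) v
  have hcross : |offsetY β v * (10000 * ((siteX (β w) : ℝ) - siteX (β u)) + offsetX β w)| ≤
      640100 := by
    rw [abs_mul, abs_of_nonneg c1]
    have : |10000 * ((siteX (β w) : ℝ) - siteX (β u)) + offsetX β w| ≤ 640100 := by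
      rw [abs_le]
      constructor <;> linarith
    nlinarith [abs_nonneg (10000 * ((siteX (β w) : ℝ) - siteX (β u)) + offsetX β w)]
  rw [abs_le] at hcross
  obtain ⟨d1, d2⟩ := hcross
  rcases siteY_sub_cases hwu with h | h
  · exact mul_pos_of_neg_of_neg (by linarith) (by linarith)
  · exact mul_pos (by linarith) (by linarith)

lemma mul_pos_of_mul_pos_of_mul_pos {a b A B : ℝ} (ha : 0 < a * A) (hb : 0 < b * B)
    (hAB : 0 < A * B) : 0 < a * b := by
  have h : 0 < (a * b) * (A * B) := by
    have := mul_pos ha hb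
    linarith
  exact pos_of_mul_pos_left h hAB.le

lemma drawing_injective : Function.Injective (drawing β) := by
  intro u v h
  have hx : 10000 * (siteX (β u) : ℝ) + offsetX β u = 10000 * (siteX (β v) : ℝ) + offsetX β v :=
    congrFun (congrArg WithLp.ofLp h) 0
  have hy : 10000 * (siteY (β u) : ℝ) + offsetY β u = 10000 * (siteY (β v) : ℝ) + offsetY β v :=
    congrFun (congrArg WithLp.ofLp h) 1
  have hu := offsetY_mem (β := β) u
  have hv := offsetY_mem (β := β) v
  by_cases hβ : β u = β v
  · by_contra huv
    rw [hβ, add_right_inj] at hy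
    by_cases hv' : IsFirst β v
    · by_cases hu' : IsFirst β u
      · exact huv (hu'.eq hv' hβ)
      · exact offsetY_ne hu' (Ne.symm huv) hy.symm
    · exact offsetY_ne hv' huv hy
  · rcases siteY_sub_cases hβ with h | h <;> linarith

/-- The edges of the graph are the edges between sites and the pendant edges. -/
lemma siteGraph_adj_cases {u v : Fin n} (h : (siteGraph β).Adj u v) :
    (IsFirst β u ∧ IsFirst β v ∧ siteAdj (β u) (β v)) ∨
    (β u = β v ∧ (IsFirst β u ∧ ¬ IsFirst β v ∨ IsFirst β v ∧ ¬ IsFirst β u)) := by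
  rcases h with h | ⟨h, hne, h' | h'⟩
  · exact .inl h
  · exact .inr ⟨h, .inl ⟨h', fun hv => hne (h'.eq hv h)⟩⟩
  · exact .inr ⟨h, .inr ⟨h', fun hu => hne (hu.eq h' h)⟩⟩

lemma orient_drawing_mul_pos_of_pendant {u v x y : Fin n} (huv : β u = β v)
    (hfirst : IsFirst β u ∧ ¬ IsFirst β v ∨ IsFirst β v ∧ ¬ IsFirst β u)
    (hxy : β x = β y) (hxu : β x ≠ β u) :
    0 < orient (drawing β u) (drawing β v) (drawing β x) *
      orient (drawing β u) (drawing β v) (drawing β y) := by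
  have key : ∀ {u v : Fin n}, β u = β v → IsFirst β u → ¬ IsFirst β v → β x ≠ β u →
      0 < orient (drawing β u) (drawing β v) (drawing β x) *
        orient (drawing β u) (drawing β v) (drawing β y) := by
    intro u v huv hu hv hxu
    refine mul_pos_of_mul_pos_of_mul_pos (orient_drawing_mul_siteY_pos huv hu hv hxu)
      (orient_drawing_mul_siteY_pos huv hu hv (hxy ▸ hxu)) ?_
    rw [← hxy]
    rcases siteY_sub_cases hxu with h | h <;> nlinarith
  rcases hfirst with ⟨hu, hv⟩ | ⟨hv, hu⟩
  · exact key huv hu hv hxu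
  · rw [orient_swap (drawing β v), orient_swap (drawing β v), neg_mul_neg]
    exact key huv.symm hv hu (huv ▸ hxu)

lemma orient_drawing_ne_zero {u v w : Fin n} (huv : (siteGraph β).Adj u v) (hwu : w ≠ u)
    (hwv : w ≠ v) : orient (drawing β u) (drawing β v) (drawing β w) ≠ 0 := by
  rcases siteGraph_adj_cases huv with ⟨hu, hv, hadj⟩ | ⟨hβ, hfirst⟩
  · have hne : β v ≠ β u := by
      intro h
      rw [h, siteAdj_irrefl] at hadj
      exact Bool.false_ne_true hadj
    by_cases hw : β w = β u ∨ β w = β v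
    · have hw' : ¬ IsFirst β w := fun hf => hw.elim (fun h => hwu (hf.eq hu h))
        (fun h => hwv (hf.eq hv h))
      have hzero : siteOrient (β u) (β v) (β w) = 0 := by
        rcases hw with h | h <;> rw [h, siteOrient] <;> ring
      rw [orient_drawing_of_isFirst hu hv, hzero, offsetX, if_neg hw']
      obtain ⟨x1, x2⟩ := siteX_sub_mem (β v) (β u)
      obtain ⟨b1, b2⟩ := offsetY_mem (β := β) w
      rcases siteY_sub_cases hne with h | h
      · apply ne_of_gt
        push_cast
        nlinarith
      · apply ne_of_lt
        push_cast
        nlinarith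
    · rw [not_or] at hw
      exact left_ne_zero_of_mul (orient_drawing_mul_siteOrient_pos hu hv hadj hw.1 hw.2).ne'
  · by_cases hw : β w = β u
    · have key : ∀ {u v : Fin n}, w ≠ u → w ≠ v → β w = β u → β u = β v → IsFirst β u →
          ¬ IsFirst β v → orient (drawing β u) (drawing β v) (drawing β w) ≠ 0 := by
        intro u v hwu hwv hw huv hu hv
        have hw' : ¬ IsFirst β w := fun hf => hwu (hf.eq hu hw)
        rw [orient_drawing_of_pendant huv hu hv, hw, offsetX, if_neg hw']
        have := sub_ne_zero.2 (offsetY_ne hv hwv)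
        intro h
        apply this
        linarith
      rcases hfirst with ⟨hu, hv⟩ | ⟨hv, hu⟩
      · exact key hwu hwv hw hβ hu hv
      · rw [orient_swap (drawing β v), neg_ne_zero]
        exact key hwv hwu (hw.trans hβ) hβ.symm hv hu
    · exact left_ne_zero_of_mul (orient_drawing_mul_pos_of_pendant hβ hfirst rfl hw).ne'

theorem isSLEmbedding_drawing (β : Fin n → Site) : IsSLEmbedding (siteGraph β) (drawing β) := by
  refine isSLEmbedding_of_orient drawing_injective (fun u v w => orient_drawing_ne_zero) ?_
  have hsite : ∀ {u v x y : Fin n}, IsFirst β u → IsFirst β v → siteAdj (β u) (β v) →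
      β x = β y → (IsFirst β x ∧ ¬ IsFirst β y ∨ IsFirst β y ∧ ¬ IsFirst β x) →
      u ≠ x → u ≠ y → v ≠ x → v ≠ y →
      0 < orient (drawing β u) (drawing β v) (drawing β x) *
        orient (drawing β u) (drawing β v) (drawing β y) := by
    intro u v x y hu hv huv hxy hfirst hux huy hvx hvy
    have hne : β x ≠ β u ∧ β x ≠ β v := by
      rcases hfirst with ⟨hx, -⟩ | ⟨hy, -⟩
      · exact ⟨fun h => hux (hu.eq hx h.symm), fun h => hvx (hv.eq hx h.symm)⟩
      · rw [hxy]
        exact ⟨fun h => huy (hu.eq hy h.symm), fun h => hvy (hv.eq hy h.symm)⟩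
    refine mul_pos_of_mul_pos_of_mul_pos (orient_drawing_mul_siteOrient_pos hu hv huv hne.1 hne.2)
      (orient_drawing_mul_siteOrient_pos hu hv huv (hxy ▸ hne.1) (hxy ▸ hne.2)) ?_
    rw [← hxy]
    exact mul_self_pos.2 (Int.cast_ne_zero.2 (siteOrient_ne_zero _ _ huv _ hne.1 hne.2))
  intro u v x y huv hxy hux huy hvx hvy
  rcases siteGraph_adj_cases huv with ⟨hu, hv, hadj⟩ | ⟨hβ, hfirst⟩ <;>
    rcases siteGraph_adj_cases hxy with ⟨hx, hy, hadj'⟩ | ⟨hβ', hfirst'⟩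
  · have h1 : β x ≠ β u := fun h => hux (hu.eq hx h.symm)
    have h2 : β y ≠ β u := fun h => huy (hu.eq hy h.symm)
    have h3 : β x ≠ β v := fun h => hvx (hv.eq hx h.symm)
    have h4 : β y ≠ β v := fun h => hvy (hv.eq hy h.symm)
    rcases siteOrient_mul_pos _ _ hadj _ _ hadj' h1.symm h2.symm h3.symm h4.symm with h | h
    · exact .inl (mul_pos_of_mul_pos_of_mul_pos (orient_drawing_mul_siteOrient_pos hu hv hadj h1 h3)
        (orient_drawing_mul_siteOrient_pos hu hv hadj h2 h4) (by exact_mod_cast h))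
    · exact .inr (mul_pos_of_mul_pos_of_mul_pos
        (orient_drawing_mul_siteOrient_pos hx hy hadj' h1.symm h2.symm)
        (orient_drawing_mul_siteOrient_pos hx hy hadj' h3.symm h4.symm) (by exact_mod_cast h))
  · exact .inl (hsite hu hv hadj hβ' hfirst' hux huy hvx hvy)
  · exact .inr (hsite hx hy hadj' hβ hfirst hux.symm hvx.symm huy.symm hvy.symm)
  · refine .inl (orient_drawing_mul_pos_of_pendant hβ hfirst hβ' fun h => ?_)
    rcases hfirst with ⟨hu, -⟩ | ⟨hv, -⟩ <;> rcases hfirst' with ⟨hx, -⟩ | ⟨hy, -⟩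
    · exact hux (hu.eq hx h.symm)
    · exact huy (hu.eq hy (h.symm.trans hβ'))
    · exact hvx (hv.eq hx (hβ.symm.trans h.symm))
    · exact hvy (hv.eq hy (hβ.symm.trans (h.symm.trans hβ')))

end Drawing

/-! ### Core positions determine the sizes of the faces -/

lemma coreAdj_corner : ∀ f, coreAdj (corner f 0) (corner f 1) ∧ coreAdj (corner f 1) (corner f 2) ∧
    coreAdj (corner f 0) (corner f 2) := by decide

lemma coreAdj_apex : ∀ f k, coreAdj (apex f) (corner f k) := by decide

lemma exists_corner_ne : ∀ f g, f ≠ g → ∃ k, ∀ l, corner g k ≠ corner f l := by decide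

/-- Removing the corners of a face leaves the core connected. -/
lemma core_connected : ∀ f i, (∀ l, i ≠ corner f l) → i = apex f ∨ coreAdj i (apex f) ∨
    ∃ j, (∀ l, j ≠ corner f l) ∧ coreAdj i j ∧ coreAdj j (apex f) := by decide

section Faces

variable {n : ℕ} {c : Fin 6 → Fin n} {β : Fin n → Site} {π : Fin n → Plane}

/-- The core sites consist of single vertices, given by `c`. -/
def HasCore (c : Fin 6 → Fin n) (β : Fin n → Site) : Prop := ∀ v i, β v = .inl i ↔ v = c i

lemma HasCore.apply_core (hc : HasCore c β) (i : Fin 6) : β (c i) = .inl i := (hc _ i).2 rfl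

lemma HasCore.injective (hc : HasCore c β) : Function.Injective c := fun i j hij =>
  Sum.inl_injective (by rw [← hc.apply_core i, ← hc.apply_core j, hij])

lemma HasCore.isFirst (hc : HasCore c β) (i : Fin 6) : IsFirst β (c i) := fun u hu =>
  ((hc u i).1 (hu.trans (hc.apply_core i))).ge

lemma HasCore.adj (hc : HasCore c β) {i j : Fin 6} (hij : coreAdj i j) :
    (siteGraph β).Adj (c i) (c j) :=
  .inl ⟨hc.isFirst i, hc.isFirst j, by rw [hc.apply_core, hc.apply_core]; exact hij⟩

lemma HasCore.adj_corner (hc : HasCore c β) {v : Fin n} {f : Fin 8} (hv : β v = .inr f)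
    (hfirst : IsFirst β v) (k : Fin 3) : (siteGraph β).Adj v (c (corner f k)) := by
  refine .inl ⟨hfirst, hc.isFirst _, ?_⟩
  rw [hc.apply_core, hv]
  fin_cases k <;> simp [siteAdj]

lemma HasCore.ne_of_inr (hc : HasCore c β) {v : Fin n} {f : Fin 8} (hv : β v = .inr f)
    (i : Fin 6) : v ≠ c i := by
  rintro rfl
  simp [hc.apply_core] at hv

/-- The triangle spanned by the corners of a face. -/
def faceTriangle (p : Fin 6 → Plane) (f : Fin 8) : Set Plane :=
  convexHull ℝ {p (corner f 0), p (corner f 1), p (corner f 2)}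

/-- In any embedding, the triangle of a face separates the vertices assigned to that face from
the remaining vertices. -/
lemma face_iff (hc : HasCore c β) (h : IsSLEmbedding (siteGraph β) π) (f : Fin 8) {v : Fin n}
    (hv : ∀ l, v ≠ c (corner f l)) :
    β v = .inr f ↔
      (π v ∈ faceTriangle (π ∘ c) f ↔ π (c (apex f)) ∉ faceTriangle (π ∘ c) f) := by
  have hcorner := coreAdj_corner f
  have hne : ∀ {w : Fin n}, (∀ l, w ≠ c (corner f l)) →
      w ≠ c (corner f 0) ∧ w ≠ c (corner f 1) ∧ w ≠ c (corner f 2) :=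
    fun hw => ⟨hw 0, hw 1, hw 2⟩
  have hadj : ∀ {u w : Fin n}, (∀ l, u ≠ c (corner f l)) → (∀ l, w ≠ c (corner f l)) →
      (siteGraph β).Adj u w →
      (π u ∈ faceTriangle (π ∘ c) f ↔ π w ∈ faceTriangle (π ∘ c) f) := fun hu hw huw =>
    h.mem_triangle_iff_of_adj (hc.adj hcorner.1) (hc.adj hcorner.2.1) (hc.adj hcorner.2.2) huw
      (hne hu) (hne hw)
  have hapex : ∀ l, c (apex f) ≠ c (corner f l) := fun l => (hc.adj (coreAdj_apex f l)).ne
  have hsite : ∀ {g : Fin 8} {u w : Fin n}, β u = .inr g → β w = β u → IsFirst β u →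
      (π w ∈ faceTriangle (π ∘ c) f ↔ π u ∈ faceTriangle (π ∘ c) f) := by
    intro g u w hu hwu hfirst
    rcases eq_or_ne w u with rfl | hne
    · rfl
    · exact hadj (fun l => hc.ne_of_inr (hwu.trans hu) _) (fun l => hc.ne_of_inr hu _)
        (.inr ⟨hwu, hne, .inr hfirst⟩)
  have hcore : ∀ i, (∀ l, i ≠ corner f l) →
      (π (c i) ∈ faceTriangle (π ∘ c) f ↔ π (c (apex f)) ∈ faceTriangle (π ∘ c) f) := by
    intro i hi
    have hi' := fun l => hc.injective.ne (hi l)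
    rcases core_connected f i hi with rfl | h1 | ⟨j, hj, h1, h2⟩
    · rfl
    · exact hadj hi' hapex (hc.adj h1)
    · have hj' := fun l => hc.injective.ne (hj l)
      exact (hadj hi' hj' (hc.adj h1)).trans (hadj hj' hapex (hc.adj h2))
  constructor
  · intro hvf
    obtain ⟨s, hs, hsv⟩ := exists_isFirst β v
    have hsf := hsv.trans hvf
    rw [hsite hsf hsv.symm hs]
    exact h.mem_triangle_iff_notMem (hc.adj hcorner.1) (hc.adj hcorner.2.1) (hc.adj hcorner.2.2)
      (hc.adj_corner hsf hs 0) (hc.adj_corner hsf hs 1) (hc.adj_corner hsf hs 2)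
      (hc.adj (coreAdj_apex f 0)) (hc.adj (coreAdj_apex f 1)) (hc.adj (coreAdj_apex f 2))
      (hc.ne_of_inr hsf _)
  · intro hiff
    by_contra hvf
    have hsame : π v ∈ faceTriangle (π ∘ c) f ↔ π (c (apex f)) ∈ faceTriangle (π ∘ c) f := by
      rcases hβ : β v with i | g
      · obtain rfl := (hc v i).1 hβ
        exact hcore i fun l hl => hv l (hl ▸ rfl)
      · have hgf : f ≠ g := by
          rintro rfl
          exact hvf hβ
        obtain ⟨s, hs, hsv⟩ := exists_isFirst β v
        have hsg := hsv.trans hβ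
        obtain ⟨k, hk⟩ := exists_corner_ne f g hgf
        rw [hsite hsg hsv.symm hs, ← hcore _ hk]
        exact hadj (fun l => hc.ne_of_inr hsg _) (fun l => hc.injective.ne (hk l))
          (hc.adj_corner hsg hs k)
    tauto

/-- The image of the vertices assigned to a face is determined by the point set and the positions
of the core vertices. -/
lemma image_face (hc : HasCore c β) (h : IsSLEmbedding (siteGraph β) π) (f : Fin 8) :
    π '' {v | β v = .inr f} = {x ∈ Set.range π | (∀ l, x ≠ π (c (corner f l))) ∧
      (x ∈ faceTriangle (π ∘ c) f ↔ π (c (apex f)) ∉ faceTriangle (π ∘ c) f)} := by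
  ext x
  constructor
  · rintro ⟨v, hv, rfl⟩
    have hne : ∀ l, v ≠ c (corner f l) := fun l => hc.ne_of_inr hv _
    exact ⟨⟨v, rfl⟩, fun l => h.1.ne (hne l), (face_iff hc h f hne).1 hv⟩
  · rintro ⟨⟨v, rfl⟩, hne, hiff⟩
    exact ⟨v, (face_iff hc h f fun l hl => hne l (hl ▸ rfl)).2 hiff, rfl⟩

/-- Two of the graphs that are embedded on the same points with the same core positions have
the same number of vertices in every face. -/
lemma ncard_face_eq {β' : Fin n → Site} {π' : Fin n → Plane} (hc : HasCore c β)
    (hc' : HasCore c β') (h : IsSLEmbedding (siteGraph β) π)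
    (h' : IsSLEmbedding (siteGraph β') π') (hrange : Set.range π = Set.range π')
    (hcore : π ∘ c = π' ∘ c) (f : Fin 8) :
    {v | β v = .inr f}.ncard = {v | β' v = .inr f}.ncard := by
  have happ : ∀ i, π (c i) = π' (c i) := congrFun hcore
  rw [← Set.ncard_image_of_injective _ h.1, ← Set.ncard_image_of_injective _ h'.1,
    image_face hc h, image_face hc' h', hrange, hcore]
  simp only [happ]

end Faces

/-! ### Counting -/

/-- Every distribution of the non-core vertices over the faces is realized. -/
lemma exists_hasCore {n : ℕ} (hn : 6 ≤ n) (s : Sym (Fin 8) (n - 6)) :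
    ∃ β : Fin n → Site, HasCore (Fin.castLE hn) β ∧
      ∀ f, {v | β v = .inr f}.ncard = (s : Multiset (Fin 8)).count f := by
  have hfun : ∀ (m : ℕ) (s : Sym (Fin 8) m),
      ∃ g : Fin m → Fin 8, Finset.univ.val.map g = (s : Multiset (Fin 8)) := by
    rintro m ⟨q, hm⟩
    induction q using Quot.inductionOn with
    | h l =>
      obtain rfl : l.length = m := hm
      refine ⟨l.get, ?_⟩
      change ((List.finRange l.length).map l.get : Multiset (Fin 8)) = l
      rw [List.map_get_finRange]
  obtain ⟨g, hg⟩ := hfun _ s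
  refine ⟨fun v => if h : v.val < 6 then .inl ⟨v, h⟩ else .inr (g ⟨v - 6, by omega⟩), ?_, ?_⟩
  · intro v i
    rw [Fin.ext_iff]
    by_cases h : v.val < 6
    · simp [h, Fin.ext_iff]
    · simp only [h, dite_false, reduceCtorEq, false_iff, Fin.val_castLE]
      omega
  · intro f
    have himage : {v : Fin n | (if h : v.val < 6 then .inl ⟨v, h⟩
        else .inr (g ⟨v - 6, by omega⟩) : Site) = .inr f} =
        (fun j : Fin (n - 6) => (⟨j + 6, by omega⟩ : Fin n)) '' {j | g j = f} := by
      ext v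
      simp only [Set.mem_image, Set.mem_ofPred_eq]
      constructor
      · intro hv
        by_cases h : v.val < 6
        · simp [h] at hv
        · simp only [h, dite_false, Sum.inr.injEq] at hv
          exact ⟨_, hv, Fin.ext (by simp; omega)⟩
      · rintro ⟨j, hj, rfl⟩
        simp [hj]
    rw [himage, Set.ncard_image_of_injective _ (fun i j hij => by simpa [Fin.ext_iff] using hij),
      ← hg, Multiset.count_map, Set.ncard_eq_toFinset_card']
    simp [Finset.card, eq_comm]

lemma descFactorial_lt_card_sym {n : ℕ} (hn : 5040 ≤ n) :
    n.descFactorial 6 + 1 ≤ Fintype.card (Sym (Fin 8) (n - 6)) := by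
  have hcard : Fintype.card (Sym (Fin 8) (n - 6)) = (n + 1).choose 7 := by
    rw [Sym.card_sym_eq_choose, Fintype.card_fin,
      show 8 + (n - 6) - 1 = n + 1 by omega, show n - 6 = n + 1 - 7 by omega,
      Nat.choose_symm (by omega)]
  have h1 : (n + 1).descFactorial 7 = Nat.factorial 7 * (n + 1).choose 7 :=
    Nat.descFactorial_eq_factorial_mul_choose _ _
  have h2 : (n + 1).descFactorial 7 = (n + 1) * n.descFactorial 6 :=
    Nat.succ_descFactorial_succ _ _
  have h3 : 5040 ≤ n.descFactorial 6 :=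
    calc 5040 ≤ 5035 ^ 6 := by norm_num
      _ ≤ (n + 1 - 6) ^ 6 := Nat.pow_le_pow_left (by omega) 6
      _ ≤ n.descFactorial 6 := Nat.pow_sub_le_descFactorial n 6
  have h4 : 5041 * n.descFactorial 6 ≤ (n + 1) * n.descFactorial 6 :=
    Nat.mul_le_mul_right _ (by omega)
  rw [show Nat.factorial 7 = 5040 from rfl] at h1
  rw [hcard]
  omega

/-- For every `n ≥ 5040` there exists a conflict collection of `n`-vertex graphs of
cardinality exactly `n(n-1)(n-2)(n-3)(n-4)(n-5) + 1`. -/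
theorem conflict_collection_explicit (n : ℕ) (hn : 5040 ≤ n) :
    ∃ 𝒢 : Finset (SimpleGraph (Fin n)),
      ConflictCollection (↑𝒢 : Set (SimpleGraph (Fin n))) ∧
      𝒢.card = n * (n - 1) * (n - 2) * (n - 3) * (n - 4) * (n - 5) + 1 := by
  have h6 : 6 ≤ n := by omega
  choose β hcore hcount using exists_hasCore h6
  have hinj : ∀ {s s' : Sym (Fin 8) (n - 6)} {π π' : Fin n → Plane},
      IsSLEmbedding (siteGraph (β s)) π → IsSLEmbedding (siteGraph (β s')) π' →
      Set.range π = Set.range π' → π ∘ Fin.castLE h6 = π' ∘ Fin.castLE h6 → s = s' := by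
    intro s s' π π' h h' hrange hpos
    refine Subtype.ext (Multiset.ext.2 fun f => ?_)
    exact (hcount s f).symm.trans
      ((ncard_face_eq (hcore s) (hcore s') h h' hrange hpos f).trans (hcount s' f))
  have hgraph : Function.Injective fun s => siteGraph (β s) := fun s s' hss' => by
    have h := isSLEmbedding_drawing (β s)
    exact hinj h ((show siteGraph (β s) = siteGraph (β s') from hss') ▸ h) rfl rfl
  obtain ⟨S, -, hS⟩ := Finset.exists_subset_card_eq
    (s := (Finset.univ : Finset (Sym (Fin 8) (n - 6)))) (descFactorial_lt_card_sym hn)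
  refine ⟨S.map ⟨_, hgraph⟩, ⟨?_, ?_⟩, ?_⟩
  · intro G hG
    obtain ⟨s, -, rfl⟩ := Finset.mem_map.1 hG
    exact ⟨_, isSLEmbedding_drawing (β s)⟩
  · rintro ⟨P, hP, hemb⟩
    have hemb' : ∀ s : S, ∃ π : Fin n → Plane, IsSLEmbedding (siteGraph (β s)) π ∧
        Set.range π = P := fun s => hemb _ (Finset.mem_map_of_mem _ s.2)
    choose π hπ hrange using hemb'
    let pos : S → (Fin 6 ↪ P) := fun s =>
      ⟨fun i => ⟨π s (Fin.castLE h6 i), by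
        rw [← Finset.mem_coe, ← hrange s]
        exact Set.mem_range_self _⟩, fun i j hij =>
        Fin.castLE_injective h6 ((hπ s).1 (congrArg Subtype.val hij))⟩
    have hpos : Function.Injective pos := fun s s' hss' => by
      refine Subtype.ext (hinj (hπ s) (hπ s') ((hrange s).trans (hrange s').symm) ?_)
      funext i
      exact congrArg Subtype.val (DFunLike.congr_fun hss' i)
    have hle := Fintype.card_le_of_injective pos hpos
    rw [Fintype.card_embedding_eq, Fintype.card_coe, Fintype.card_coe, Fintype.card_fin, hP,
      hS] at hle
    omega
  · rw [Finset.card_map, hS]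
    simp only [Nat.descFactorial_succ, Nat.descFactorial_zero, Nat.sub_zero]
    ring
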